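/- Let M ≥ k+1 ≥ 2, with all Dunkl operators built from the M variables z_1,…,z_M. Then there exists an F-linear operator A on F[z_1,…,z_M] such that for every polynomial f ∈ F[z_1,…,z_M] that is symmetric in the variables z_1,…,z_{k+1}: [Ñ_{k+1}, B⁺_{k,{1,…,k+1}}] f = A ( Ñ_{k+1} f ). -/

import Mathlib

open MvPolynomial Finset

section CSDefs

variable {F : Type*} [Field F] [CharZero F]

/-- Exact division in a polynomial ring: `divExact d f = f / d` when `d ∣ f`, junk otherwise. -/
noncomputable def divExact {σ : Type*} (d f : MvPolynomial σ F) : MvPolynomial σ F := by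
  classical exact if h : ∃ c, f = d * c then h.choose else 0

/-- The exchange operator `K_{ij}` permuting the variables `z_i` and `z_j`. -/
noncomputable def Kswap {N : ℕ} (i j : Fin N) (f : MvPolynomial (Fin N) F) :
    MvPolynomial (Fin N) F :=
  rename (Equiv.swap i j) f

/-- The Dunkl operator `∇_i = ∂_i + β ∑_{j ≠ i} (z_i - z_j)⁻¹ (1 - K_{ij})`. -/
noncomputable def nabla {N : ℕ} (β : F) (i : Fin N) (f : MvPolynomial (Fin N) F) :
    MvPolynomial (Fin N) F :=
  pderiv i f + β • ∑ j ∈ Finset.univ.erase i, divExact (X i - X j) (f - Kswap i j f)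

/-- `D_i = z_i ∇_i`. -/
noncomputable def Dop {N : ℕ} (β : F) (i : Fin N) (f : MvPolynomial (Fin N) F) :
    MvPolynomial (Fin N) F :=
  X i * nabla β i f

/-- `(D_{j₁} + kβ)(D_{j₂} + (k+1)β) ⋯` applied along a list of indices. -/
noncomputable def Dlist {N : ℕ} (β : F) :
    ℕ → List (Fin N) → MvPolynomial (Fin N) F → MvPolynomial (Fin N) F
  | _, [], f => f
  | k, j :: rest, f => Dop β j (Dlist β (k + 1) rest f) + ((k : F) * β) • Dlist β (k + 1) rest f

/-- `D_{k,J} = (D_{j₁} + kβ)(D_{j₂} + (k+1)β) ⋯ (D_{j_ℓ} + (k+ℓ-1)β)` for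
`J = {j₁ < j₂ < … < j_ℓ}`. -/
noncomputable def DJ {N : ℕ} (β : F) (k : ℕ) (J : Finset (Fin N))
    (f : MvPolynomial (Fin N) F) : MvPolynomial (Fin N) F :=
  Dlist β k (J.sort (· ≤ ·)) f

/-- `z_J = ∏_{i ∈ J} z_i`. -/
noncomputable def zJ {N : ℕ} (J : Finset (Fin N)) : MvPolynomial (Fin N) F := ∏ i ∈ J, X i

/-- The creation operator `B⁺_{i,J} = ∑_{J' ⊆ J, |J'| = i} z_{J'} D_{1,J'}`. -/
noncomputable def Bplus {N : ℕ} (β : F) (i : ℕ) (J : Finset (Fin N))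
    (f : MvPolynomial (Fin N) F) : MvPolynomial (Fin N) F :=
  ∑ J' ∈ J.powersetCard i, zJ J' * DJ β 1 J' f

/-- `A_{ij} = ((z_i+z_j)/(z_i-z_j))(z_i ∂_i - z_j ∂_j)`. -/
noncomputable def Aop {N : ℕ} (i j : Fin N) (f : MvPolynomial (Fin N) F) :
    MvPolynomial (Fin N) F :=
  divExact (X i - X j) ((X i + X j) * (X i * pderiv i f - X j * pderiv j f))

/-- `H^{(S)} = ∑_{i ∈ S} (z_i ∂_i)² + β ∑_{i<j, i,j ∈ S} A_{ij}`. -/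
noncomputable def Hop {N : ℕ} (β : F) (S : Finset (Fin N)) (f : MvPolynomial (Fin N) F) :
    MvPolynomial (Fin N) F :=
  ∑ i ∈ S, X i * pderiv i (X i * pderiv i f)
    + β • ∑ i ∈ S, ∑ j ∈ S.filter (fun j => i < j), Aop i j f

/-- A polynomial is symmetric in the variables indexed by `S`. -/
def SymmOn {N : ℕ} (S : Finset (Fin N)) (f : MvPolynomial (Fin N) F) : Prop :=
  ∀ i ∈ S, ∀ j ∈ S, rename (Equiv.swap i j) f = f

/-- `phiCS β N lam i = (B⁺_i)^{λ_i - λ_{i+1}} ⋯ (B⁺_1)^{λ_1 - λ_2} · 1`,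
where `lam` is 0-indexed: `lam (j-1) = λ_j`. -/
noncomputable def phiCS (β : F) (N : ℕ) (lam : ℕ → ℕ) : ℕ → MvPolynomial (Fin N) F
  | 0 => 1
  | i + 1 => (fun f => Bplus β (i + 1) Finset.univ f)^[lam i - lam (i + 1)] (phiCS β N lam i)

/-- The monomial symmetric polynomial attached to an exponent vector. -/
noncomputable def msym (N : ℕ) (lam : Fin N → ℕ) : MvPolynomial (Fin N) F := by
  classical
  exact ∑ v ∈ (Finset.univ : Finset (Equiv.Perm (Fin N))).image
      (fun σ => fun i => lam (σ i)), ∏ i, X i ^ v i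

/-- `𝐷̂_i = D_i + β(i-1) - β ∑_{j<i} (1 - K_{ij})` (0-indexed: `i-1` becomes `i`). -/
noncomputable def Dhat {N : ℕ} (β : F) (i : Fin N) (f : MvPolynomial (Fin N) F) :
    MvPolynomial (Fin N) F :=
  Dop β i f + (β * ((i : ℕ) : F)) • f
    - β • ∑ j ∈ Finset.univ.filter (fun j => j < i), (f - Kswap i j f)

end CSDefs


section Exchange

variable {F : Type*} [Field F] {N : ℕ}

theorem X_sub_X_dvd_sub_rename_swap (i j : Fin N) (f : MvPolynomial (Fin N) F) :
    (X i - X j : MvPolynomial (Fin N) F) ∣ f - rename (Equiv.swap i j) f := by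
  induction f using MvPolynomial.induction_on with
  | C a => simp
  | add p q hp hq =>
    rw [map_add, add_sub_add_comm]
    exact dvd_add hp hq
  | mul_X p l hp =>
    have hX : (X i - X j : MvPolynomial (Fin N) F) ∣ X l - X (Equiv.swap i j l) := by
      rcases eq_or_ne l i with rfl | hi
      · simp
      rcases eq_or_ne l j with rfl | hj
      · rw [Equiv.swap_apply_right]
        exact ⟨-1, by ring⟩
      · simp [Equiv.swap_apply_of_ne_of_ne hi hj]
    rw [map_mul, rename_X]
    have := dvd_add (hp.mul_right (X l)) (hX.mul_left (rename (Equiv.swap i j) p))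
    convert this using 1
    ring

theorem X_sub_X_ne_zero {i j : Fin N} (h : i ≠ j) : (X i - X j : MvPolynomial (Fin N) F) ≠ 0 :=
  sub_ne_zero.2 fun e => h (X_injective e)

theorem Kswap_mul (i j : Fin N) (f g : MvPolynomial (Fin N) F) :
    Kswap i j (f * g) = Kswap i j f * Kswap i j g := map_mul _ _ _

theorem Kswap_add (i j : Fin N) (f g : MvPolynomial (Fin N) F) :
    Kswap i j (f + g) = Kswap i j f + Kswap i j g := map_add _ _ _

theorem Kswap_smul (i j : Fin N) (c : F) (f : MvPolynomial (Fin N) F) :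
    Kswap i j (c • f) = c • Kswap i j f := map_smul _ _ _

theorem Kswap_comm (i j : Fin N) (f : MvPolynomial (Fin N) F) : Kswap i j f = Kswap j i f := by
  rw [Kswap, Equiv.swap_comm, Kswap]

theorem rename_Kswap (σ : Equiv.Perm (Fin N)) (i j : Fin N) (f : MvPolynomial (Fin N) F) :
    rename σ (Kswap i j f) = Kswap (σ i) (σ j) (rename σ f) := by
  rw [Kswap, Kswap, rename_rename, rename_rename]
  congr 2
  ext x
  simp [Equiv.swap_apply_def, apply_ite σ, σ.injective.eq_iff]

/-- Defining property of the divided difference. -/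
theorem mul_divExact (i j : Fin N) (f : MvPolynomial (Fin N) F) :
    (X i - X j) * divExact (X i - X j) (f - Kswap i j f) = f - Kswap i j f := by
  have h : ∃ c, f - Kswap i j f = (X i - X j) * c := X_sub_X_dvd_sub_rename_swap i j f
  rw [divExact, dif_pos h]
  exact h.choose_spec.symm

theorem divExact_eq {i j : Fin N} (h : i ≠ j) {f g : MvPolynomial (Fin N) F}
    (hg : (X i - X j) * g = f - Kswap i j f) :
    divExact (X i - X j) (f - Kswap i j f) = g :=
  mul_left_cancel₀ (X_sub_X_ne_zero h) ((mul_divExact i j f).trans hg.symm)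

end Exchange

section DunklCommutation

variable {F : Type*} [Field F] {N : ℕ}

/-- The Dunkl operator as a linear map. -/
noncomputable def nablaLin (β : F) (i : Fin N) :
    MvPolynomial (Fin N) F →ₗ[F] MvPolynomial (Fin N) F where
  toFun := nabla β i
  map_add' f g := by
    have h : ∀ j ∈ Finset.univ.erase i,
        divExact (X i - X j) (f + g - Kswap i j (f + g)) =
          divExact (X i - X j) (f - Kswap i j f) + divExact (X i - X j) (g - Kswap i j g) := by
      intro j hj
      refine divExact_eq (Finset.ne_of_mem_erase hj).symm ?_
      rw [mul_add, mul_divExact, mul_divExact, Kswap_add]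
      ring
    rw [nabla, Finset.sum_congr rfl h, Finset.sum_add_distrib, map_add, smul_add, nabla, nabla]
    ring
  map_smul' c f := by
    have h : ∀ j ∈ Finset.univ.erase i,
        divExact (X i - X j) (c • f - Kswap i j (c • f)) =
          c • divExact (X i - X j) (f - Kswap i j f) := by
      intro j hj
      refine divExact_eq (Finset.ne_of_mem_erase hj).symm ?_
      rw [mul_smul_comm, mul_divExact, Kswap_smul, smul_sub]
    rw [nabla, Finset.sum_congr rfl h, ← Finset.smul_sum, Derivation.map_smul, smul_comm β c,
      RingHom.id_apply, nabla, smul_add]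

theorem nabla_add (β : F) (i : Fin N) (f g : MvPolynomial (Fin N) F) :
    nabla β i (f + g) = nabla β i f + nabla β i g := map_add (nablaLin β i) f g

theorem nabla_sub (β : F) (i : Fin N) (f g : MvPolynomial (Fin N) F) :
    nabla β i (f - g) = nabla β i f - nabla β i g := map_sub (nablaLin β i) f g

theorem nabla_smul (β : F) (i : Fin N) (c : F) (f : MvPolynomial (Fin N) F) :
    nabla β i (c • f) = c • nabla β i f := map_smul (nablaLin β i) c f

theorem nabla_zero (β : F) (i : Fin N) : nabla β i (0 : MvPolynomial (Fin N) F) = 0 :=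
  map_zero (nablaLin β i)

theorem nabla_sum (β : F) (i : Fin N) {ι : Type*} (s : Finset ι)
    (f : ι → MvPolynomial (Fin N) F) :
    nabla β i (∑ a ∈ s, f a) = ∑ a ∈ s, nabla β i (f a) := map_sum (nablaLin β i) f s

theorem nabla_C (β : F) (i : Fin N) (a : F) : nabla β i (C a) = 0 := by
  have h : ∀ j ∈ Finset.univ.erase i,
      divExact (X i - X j) (C a - Kswap i j (C a)) = (0 : MvPolynomial (Fin N) F) := by
    intro j hj
    refine divExact_eq (Finset.ne_of_mem_erase hj).symm ?_
    simp [Kswap]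
  rw [nabla, Finset.sum_congr rfl h]
  simp

/-- `[∇_i, z_j] = -β K_{ij}` for `i ≠ j`. -/
theorem nabla_X_mul_of_ne (β : F) {i j : Fin N} (hij : i ≠ j) (f : MvPolynomial (Fin N) F) :
    nabla β i (X j * f) = X j * nabla β i f - β • Kswap i j f := by
  have h : ∀ m ∈ Finset.univ.erase i,
      divExact (X i - X m) (X j * f - Kswap i m (X j * f)) =
        X j * divExact (X i - X m) (f - Kswap i m f) - if m = j then Kswap i j f else 0 := by
    intro m hm
    have hm' := Finset.ne_of_mem_erase hm
    refine divExact_eq hm'.symm ?_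
    rw [mul_sub, mul_left_comm, mul_divExact, Kswap_mul]
    split_ifs with e
    · subst e
      simp only [Kswap, rename_X, Equiv.swap_apply_right]
      ring
    · simp only [Kswap, rename_X, Equiv.swap_apply_of_ne_of_ne hij.symm (Ne.symm e)]
      ring
  rw [nabla, Finset.sum_congr rfl h, Finset.sum_sub_distrib, Finset.sum_ite_eq',
    if_pos (Finset.mem_erase.2 ⟨hij.symm, Finset.mem_univ _⟩), ← Finset.mul_sum, smul_sub,
    Derivation.leibniz, pderiv_X_of_ne hij.symm, nabla, mul_add, mul_smul_comm, smul_eq_mul,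
    smul_zero, add_zero]
  ring

/-- `[∇_i, z_i] = 1 + β ∑_{m ≠ i} K_{im}`. -/
theorem nabla_X_mul_self (β : F) (i : Fin N) (f : MvPolynomial (Fin N) F) :
    nabla β i (X i * f) = X i * nabla β i f + f + β • ∑ m ∈ Finset.univ.erase i, Kswap i m f := by
  have h : ∀ m ∈ Finset.univ.erase i,
      divExact (X i - X m) (X i * f - Kswap i m (X i * f)) =
        X i * divExact (X i - X m) (f - Kswap i m f) + Kswap i m f := by
    intro m hm
    refine divExact_eq (Finset.ne_of_mem_erase hm).symm ?_
    rw [mul_add, mul_left_comm, mul_divExact, Kswap_mul]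
    simp only [Kswap, rename_X, Equiv.swap_apply_left]
    ring
  rw [nabla, Finset.sum_congr rfl h, Finset.sum_add_distrib, ← Finset.mul_sum, smul_add,
    Derivation.leibniz, pderiv_X_self, nabla, mul_add, mul_smul_comm, smul_eq_mul,
    smul_eq_mul, mul_one]
  ring

theorem rename_nabla (β : F) (σ : Equiv.Perm (Fin N)) (i : Fin N) (f : MvPolynomial (Fin N) F) :
    rename σ (nabla β i f) = nabla β (σ i) (rename σ f) := by
  have h : ∀ j ∈ Finset.univ.erase i,
      rename σ (divExact (X i - X j) (f - Kswap i j f)) =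
        divExact (X (σ i) - X (σ j)) (rename σ f - Kswap (σ i) (σ j) (rename σ f)) := by
    intro j hj
    symm
    refine divExact_eq (fun e => (Finset.ne_of_mem_erase hj) (σ.injective e).symm) ?_
    have := congrArg (rename σ) (mul_divExact i j f)
    simpa [rename_Kswap] using this
  rw [nabla, nabla, map_add, map_smul, map_sum, Finset.sum_congr rfl h, pderiv_rename σ.injective]
  congr 2
  refine Finset.sum_equiv σ (by simp) (fun _ _ => rfl)

theorem Kswap_nabla (β : F) (i j l : Fin N) (f : MvPolynomial (Fin N) F) :
    Kswap i j (nabla β l f) = nabla β (Equiv.swap i j l) (Kswap i j f) :=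
  rename_nabla β _ l f

theorem Kswap_nabla_left (β : F) (i j : Fin N) (f : MvPolynomial (Fin N) F) :
    Kswap i j (nabla β i f) = nabla β j (Kswap i j f) := by
  rw [Kswap_nabla, Equiv.swap_apply_left]

theorem Kswap_nabla_right (β : F) (i j : Fin N) (f : MvPolynomial (Fin N) F) :
    Kswap i j (nabla β j f) = nabla β i (Kswap i j f) := by
  rw [Kswap_nabla, Equiv.swap_apply_right]

theorem Kswap_nabla_of_ne (β : F) {i j l : Fin N} (hi : l ≠ i) (hj : l ≠ j)
    (f : MvPolynomial (Fin N) F) :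
    Kswap i j (nabla β l f) = nabla β l (Kswap i j f) := by
  rw [Kswap_nabla, Equiv.swap_apply_of_ne_of_ne hi hj]

theorem nabla_nabla_X_mul_sub (β : F) {i j : Fin N} (hij : i ≠ j) (f : MvPolynomial (Fin N) F) :
    nabla β i (nabla β j (X i * f)) - nabla β j (nabla β i (X i * f)) =
      X i * (nabla β i (nabla β j f) - nabla β j (nabla β i f)) := by
  have h : ∀ m ∈ (Finset.univ.erase i).erase j,
      nabla β j (Kswap i m f) = Kswap i m (nabla β j f) := by
    intro m hm
    exact (Kswap_nabla_of_ne β hij.symm (Finset.ne_of_mem_erase hm).symm f).symm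
  have hj : j ∈ Finset.univ.erase i := by simp [hij.symm]
  rw [nabla_X_mul_of_ne β hij.symm, nabla_sub, nabla_smul, nabla_X_mul_self, nabla_X_mul_self,
    nabla_add, nabla_add, nabla_X_mul_of_ne β hij.symm, nabla_smul, nabla_sum,
    ← Finset.add_sum_erase _ _ hj, ← Finset.add_sum_erase _ _ hj, Finset.sum_congr rfl h,
    Kswap_nabla_right β i j, Kswap_comm j i f, Kswap_comm j i (nabla β i f),
    Kswap_nabla_left β i j, mul_sub]
  module

/-- The Dunkl operators commute. -/
theorem nabla_comm (β : F) (i j : Fin N) (f : MvPolynomial (Fin N) F) :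
    nabla β i (nabla β j f) = nabla β j (nabla β i f) := by
  rcases eq_or_ne i j with rfl | hij
  · rfl
  rw [← sub_eq_zero]
  induction f using MvPolynomial.induction_on with
  | C a => simp [nabla_C, nabla_zero]
  | add p q hp hq =>
    simp only [nabla_add]
    rw [add_sub_add_comm, hp, hq, add_zero]
  | mul_X p l hp =>
    rw [mul_comm]
    rcases eq_or_ne l i with rfl | hi
    · rw [nabla_nabla_X_mul_sub β hij, hp, mul_zero]
    rcases eq_or_ne l j with rfl | hj
    · rw [← neg_sub, nabla_nabla_X_mul_sub β hij.symm, ← neg_sub, hp]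
      simp
    · rw [nabla_X_mul_of_ne β hj.symm, nabla_X_mul_of_ne β hi.symm, nabla_sub, nabla_sub,
        nabla_smul, nabla_smul, nabla_X_mul_of_ne β hj.symm, nabla_X_mul_of_ne β hi.symm,
        Kswap_nabla_of_ne β hij.symm hj.symm, Kswap_nabla_of_ne β hij hi.symm,
        sub_eq_zero.1 hp]
      module

end DunklCommutation

section DunklProducts

variable {F : Type*} [Field F] {N : ℕ}

/-- The product `∇_{l₁} ∇_{l₂} ⋯` of Dunkl operators along a list of indices. -/
noncomputable def nablaList (β : F) (l : List (Fin N)) :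
    MvPolynomial (Fin N) F →ₗ[F] MvPolynomial (Fin N) F :=
  (l.map (nablaLin β) : List (Module.End F (MvPolynomial (Fin N) F))).prod

theorem nablaList_nil (β : F) (f : MvPolynomial (Fin N) F) : nablaList β [] f = f := rfl

theorem nablaList_cons (β : F) (i : Fin N) (l : List (Fin N)) (f : MvPolynomial (Fin N) F) :
    nablaList β (i :: l) f = nabla β i (nablaList β l f) := by
  simp only [nablaList, List.map_cons, List.prod_cons]
  rfl

theorem nablaList_append (β : F) (l l' : List (Fin N)) (f : MvPolynomial (Fin N) F) :
    nablaList β (l ++ l') f = nablaList β l (nablaList β l' f) := by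
  simp only [nablaList, List.map_append, List.prod_append]
  rfl

theorem nablaList_perm (β : F) {l l' : List (Fin N)} (h : l.Perm l')
    (f : MvPolynomial (Fin N) F) : nablaList β l f = nablaList β l' f := by
  induction h with
  | nil => rfl
  | cons x _ ih => rw [nablaList_cons, nablaList_cons, ih]
  | swap x y l => simp only [nablaList_cons, nabla_comm β x y]
  | trans _ _ ih₁ ih₂ => rw [ih₁, ih₂]

theorem nabla_nablaList (β : F) (i : Fin N) (l : List (Fin N)) (f : MvPolynomial (Fin N) F) :
    nabla β i (nablaList β l f) = nablaList β l (nabla β i f) := by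
  induction l with
  | nil => rfl
  | cons j l ih => rw [nablaList_cons, nablaList_cons, nabla_comm, ih]

theorem Kswap_nablaList (β : F) {i j : Fin N} {l : List (Fin N)} (hi : i ∉ l) (hj : j ∉ l)
    (f : MvPolynomial (Fin N) F) :
    Kswap i j (nablaList β l f) = nablaList β l (Kswap i j f) := by
  induction l with
  | nil => rfl
  | cons m l ih =>
    rw [List.mem_cons, not_or] at hi hj
    rw [nablaList_cons, nablaList_cons, Kswap_nabla_of_ne β (Ne.symm hi.1) (Ne.symm hj.1),
      ih hi.2 hj.2]

theorem Kswap_prod_X {i j : Fin N} {l : List (Fin N)} (hi : i ∉ l) (hj : j ∉ l) :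
    Kswap i j (l.map X).prod = ((l.map X).prod : MvPolynomial (Fin N) F) := by
  induction l with
  | nil => simp [Kswap]
  | cons m l ih =>
    rw [List.mem_cons, not_or] at hi hj
    rw [List.map_cons, List.prod_cons, Kswap_mul, ih hi.2 hj.2, Kswap, rename_X,
      Equiv.swap_apply_of_ne_of_ne (Ne.symm hi.1) (Ne.symm hj.1)]

/-- Commuting `z_a` through a product of Dunkl operators applied to `∇_a f`. -/
theorem nablaList_X_mul_nabla (β : F) {a : Fin N} {l : List (Fin N)} (hl : l.Nodup) (ha : a ∉ l)
    {f : MvPolynomial (Fin N) F} (hf : ∀ i ∈ l, Kswap i a f = f) :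
    nablaList β l (X a * nabla β a f) =
      X a * nablaList β l (nabla β a f) - ((l.length : F) * β) • nablaList β l f := by
  induction l with
  | nil => simp [nablaList_nil]
  | cons i l ih =>
    rw [List.mem_cons, not_or] at ha
    rw [List.nodup_cons] at hl
    rw [nablaList_cons, ih hl.2 ha.2 fun m hm => hf m (List.mem_cons_of_mem _ hm), nabla_sub,
      nabla_X_mul_of_ne β (Ne.symm ha.1), nabla_smul, Kswap_nablaList β hl.1 ha.2,
      Kswap_nabla_right, hf i List.mem_cons_self, ← nabla_nablaList β i l f, nablaList_cons,
      nablaList_cons, List.length_cons]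
    push_cast
    module

/-- Commuting `z_i` to the left through `∇_T`; the right-hand side depends only on `∇_T w`. -/
theorem nabla_nablaList_X_mul (β : F) {i : Fin N} {l : List (Fin N)} (hl : l.Nodup) (hi : i ∉ l)
    (w : MvPolynomial (Fin N) F) :
    nabla β i (nablaList β l (X i * w)) =
      nabla β i (X i * nablaList β l w) -
        β • ∑ s ∈ l.toFinset, Kswap i s (nablaList β l w) := by
  induction l with
  | nil => simp [nablaList_nil]
  | cons s l ih =>
    rw [List.mem_cons, not_or] at hi
    rw [List.nodup_cons] at hl
    have h : ∀ m ∈ l.toFinset, nabla β s (Kswap i m (nablaList β l w)) =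
        Kswap i m (nabla β s (nablaList β l w)) := by
      intro m hm
      refine (Kswap_nabla_of_ne β (Ne.symm hi.1) ?_ _).symm
      rintro rfl
      exact hl.1 (List.mem_toFinset.1 hm)
    rw [nablaList_cons, nabla_comm, ih hl.2 hi.2, nabla_sub, nabla_smul, nabla_sum,
      Finset.sum_congr rfl h, nabla_comm, nabla_X_mul_of_ne β (Ne.symm hi.1), nabla_sub,
      nabla_smul, Kswap_comm s i, ← Kswap_nabla_right, nablaList_cons, List.toFinset_cons,
      Finset.sum_insert (by simpa using hl.1)]
    module

/-- If `∇_j h = 0`, then `∇_S ∇_j (z_S h) = 0` for every `S` not containing `j`. -/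
theorem nablaList_nabla_prod_X_mul_eq_zero (β : F) {l : List (Fin N)} (hl : l.Nodup) {j : Fin N}
    (hj : j ∉ l) {h : MvPolynomial (Fin N) F} (hh : nabla β j h = 0) :
    nablaList β l (nabla β j ((l.map X).prod * h)) = 0 := by
  induction l generalizing j h with
  | nil => simpa [nablaList_nil] using hh
  | cons i l ih =>
    rw [List.mem_cons, not_or] at hj
    rw [List.nodup_cons] at hl
    have h₁ : nablaList β l (nabla β j ((l.map X).prod * h)) = 0 := ih hl.2 hj.2 hh
    have h₂ : nablaList β l (nabla β i ((l.map X).prod * Kswap j i h)) = 0 := by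
      refine ih hl.2 hl.1 ?_
      rw [← Kswap_nabla_left, hh, Kswap, map_zero]
    rw [List.map_cons, List.prod_cons, mul_assoc, nabla_X_mul_of_ne β hj.1, map_sub, map_smul,
      nablaList_cons, nablaList_cons, nabla_nablaList_X_mul β hl.2 hl.1, h₁, Kswap_mul,
      Kswap_prod_X hj.2 hl.1, nabla_nablaList, h₂]
    simp [Kswap, nabla_zero]

end DunklProducts

section CommutatorKernel

variable {F : Type*} [Field F] {N : ℕ}

/-- `Dlist` as a linear map. -/
noncomputable def DlistLin (β : F) (k : ℕ) (l : List (Fin N)) :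
    MvPolynomial (Fin N) F →ₗ[F] MvPolynomial (Fin N) F where
  toFun := Dlist β k l
  map_add' f g := by
    induction l generalizing k with
    | nil => rfl
    | cons j l ih =>
      simp only [Dlist, Dop, ih, nabla_add, mul_add]
      module
  map_smul' c f := by
    induction l generalizing k with
    | nil => rfl
    | cons j l ih =>
      simp only [Dlist, Dop, ih, nabla_smul, RingHom.id_apply, mul_smul_comm]
      module

/-- `Bplus` as a linear map. -/
noncomputable def BplusLin (β : F) (i : ℕ) (J : Finset (Fin N)) :
    MvPolynomial (Fin N) F →ₗ[F] MvPolynomial (Fin N) F :=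
  ∑ J' ∈ J.powersetCard i, (LinearMap.mulLeft F (zJ J')).comp (DlistLin β 1 (J'.sort (· ≤ ·)))

theorem BplusLin_apply (β : F) (i : ℕ) (J : Finset (Fin N)) (f : MvPolynomial (Fin N) F) :
    BplusLin β i J f = Bplus β i J f := by
  simp only [BplusLin, LinearMap.sum_apply, Bplus]
  rfl

theorem rename_Dlist (β : F) (σ : Equiv.Perm (Fin N)) (k : ℕ) (l : List (Fin N))
    (f : MvPolynomial (Fin N) F) :
    rename σ (Dlist β k l f) = Dlist β k (l.map σ) (rename σ f) := by
  induction l generalizing k with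
  | nil => rfl
  | cons j l ih =>
    simp only [Dlist, Dop, List.map_cons, map_add, map_mul, map_smul, rename_X, rename_nabla, ih]

theorem Kswap_Dlist_of_notMem (β : F) {i j : Fin N} (k : ℕ) {l : List (Fin N)} (hi : i ∉ l)
    (hj : j ∉ l) (f : MvPolynomial (Fin N) F) :
    Kswap i j (Dlist β k l f) = Dlist β k l (Kswap i j f) := by
  have h : l.map (Equiv.swap i j) = l := by
    refine (List.map_congr_left fun x hx => ?_).trans (List.map_id l)
    exact Equiv.swap_apply_of_ne_of_ne (fun e => hi (e ▸ hx)) (fun e => hj (e ▸ hx))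
  rw [Kswap, rename_Dlist, h, Kswap]

/-- Consecutive shifted factors may be exchanged on functions invariant under `K_{ij}`. -/
theorem Dop_shift_swap (β c : F) {i j : Fin N} (hij : i ≠ j) {g : MvPolynomial (Fin N) F}
    (hg : Kswap i j g = g) :
    Dop β i (Dop β j g + (c + β) • g) + c • (Dop β j g + (c + β) • g) =
      Dop β j (Dop β i g + (c + β) • g) + c • (Dop β i g + (c + β) • g) := by
  have h₁ : Kswap i j (nabla β j g) = nabla β i g := by rw [Kswap_nabla_right, hg]
  have h₂ : Kswap j i (nabla β i g) = nabla β j g := by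
    rw [Kswap_comm, Kswap_nabla_left, hg]
  simp only [Dop, nabla_add, nabla_smul, nabla_X_mul_of_ne β hij, nabla_X_mul_of_ne β hij.symm,
    h₁, h₂, nabla_comm β j i]
  simp only [MvPolynomial.smul_eq_C_mul, map_add]
  ring

theorem Dlist_perm (β : F) {l l' : List (Fin N)} (h : l.Perm l') (hl : l.Nodup)
    {f : MvPolynomial (Fin N) F} (hf : ∀ i ∈ l, ∀ j ∈ l, Kswap i j f = f) (k : ℕ) :
    Dlist β k l f = Dlist β k l' f := by
  induction h generalizing k with
  | nil => rfl
  | cons x _ ih =>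
    rw [Dlist, Dlist, ih (List.nodup_cons.1 hl).2
      fun i hi j hj => hf i (List.mem_cons_of_mem _ hi) j (List.mem_cons_of_mem _ hj)]
  | swap x y l =>
    simp only [List.nodup_cons, List.mem_cons, not_or] at hl
    have hg : Kswap y x (Dlist β (k + 1 + 1) l f) = Dlist β (k + 1 + 1) l f := by
      rw [Kswap_Dlist_of_notMem β _ hl.1.2 hl.2.1, hf y (by simp) x (by simp)]
    have := Dop_shift_swap β ((k : F) * β) hl.1.1 hg
    simpa only [Dlist, Nat.cast_add, Nat.cast_one, add_mul, one_mul] using this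
  | trans h₁ _ ih₁ ih₂ =>
    rw [ih₁ hl hf, ih₂ (h₁.nodup_iff.1 hl)
      fun i hi j hj => hf i (h₁.mem_iff.2 hi) j (h₁.mem_iff.2 hj)]

theorem Dlist_append_singleton (β : F) (k : ℕ) (l : List (Fin N)) (a : Fin N)
    (f : MvPolynomial (Fin N) F) :
    Dlist β k (l ++ [a]) f = Dlist β k l (Dop β a f + (((k + l.length : ℕ) : F) * β) • f) := by
  induction l generalizing k with
  | nil => simp [Dlist]
  | cons j l ih =>
    rw [List.cons_append, Dlist, Dlist, ih, List.length_cons, add_assoc k 1, add_comm 1]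

/-- On symmetric functions, `D_{0,J} = z_J ∇_J`. -/
theorem Dlist_zero_eq (β : F) {l : List (Fin N)} (hl : l.Nodup) {f : MvPolynomial (Fin N) F}
    (hf : ∀ i ∈ l, ∀ j ∈ l, Kswap i j f = f) :
    Dlist β 0 l f = (l.map X).prod * nablaList β l f := by
  induction l using List.reverseRecOn generalizing f with
  | nil => simp [Dlist, nablaList_nil]
  | append_singleton l a ih =>
    have ha : a ∉ l := fun h => (List.nodup_append.1 hl).2.2 a h a (by simp) rfl
    have hl' : l.Nodup := (List.nodup_append.1 hl).1
    have hf' : ∀ i ∈ l, ∀ j ∈ l, Kswap i j f = f := fun i hi j hj =>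
      hf i (List.mem_append_left _ hi) j (List.mem_append_left _ hj)
    rw [Dlist_append_singleton, ih hl', Dop, map_add, map_smul,
      nablaList_X_mul_nabla β hl' ha fun i hi => hf i (List.mem_append_left _ hi) a (by simp),
      zero_add, sub_add_cancel, nablaList_append, nablaList_cons, nablaList_nil, List.map_append,
      List.prod_append, List.map_singleton, List.prod_singleton, mul_assoc]
    intro i hi j hj
    have hai : a ≠ i := fun e => ha (e ▸ hi)
    have haj : a ≠ j := fun e => ha (e ▸ hj)
    rw [Dop, Kswap_add, Kswap_smul, Kswap_mul, Kswap_nabla_of_ne β hai haj, hf' i hi j hj, Kswap,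
      rename_X, Equiv.swap_apply_of_ne_of_ne hai haj]

theorem zJ_eq_prod_sort (J : Finset (Fin N)) :
    (zJ J : MvPolynomial (Fin N) F) = ((J.sort (· ≤ ·)).map X).prod := by
  rw [zJ, ← List.prod_toFinset _ (Finset.sort_nodup _ _), Finset.sort_toFinset]

theorem sort_perm_of_nodup {J : Finset (Fin N)} {l : List (Fin N)} (hl : l.Nodup)
    (h : ∀ x, x ∈ l ↔ x ∈ J) : l.Perm (J.sort (· ≤ ·)) :=
  (List.perm_ext_iff_of_nodup hl (Finset.sort_nodup _ _)).2 fun x => by simp [h]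

theorem rename_DJ (β : F) (σ : Equiv.Perm (Fin N)) (k : ℕ) (J : Finset (Fin N))
    {f : MvPolynomial (Fin N) F} (hf : SymmOn (J.map σ.toEmbedding) (rename σ f)) :
    rename σ (DJ β k J f) = DJ β k (J.map σ.toEmbedding) (rename σ f) := by
  rw [DJ, rename_Dlist, DJ]
  refine Dlist_perm β (sort_perm_of_nodup ((Finset.sort_nodup _ _).map σ.injective) ?_)
    ((Finset.sort_nodup _ _).map σ.injective) ?_ k
  · simp [-Finset.mem_map_equiv]
  · intro i hi j hj
    exact hf i (by simpa [-Finset.mem_map_equiv] using hi) j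
      (by simpa [-Finset.mem_map_equiv] using hj)

theorem SymmOn.mono {S T : Finset (Fin N)} {f : MvPolynomial (Fin N) F} (hf : SymmOn T f)
    (h : S ⊆ T) : SymmOn S f := fun i hi j hj => hf i (h hi) j (h hj)

/-- `B⁺_{i,J}` preserves symmetry in the variables indexed by `J`. -/
theorem SymmOn.Bplus {β : F} {i : ℕ} {J : Finset (Fin N)} {f : MvPolynomial (Fin N) F}
    (hf : SymmOn J f) : SymmOn J (Bplus β i J f) := by
  intro a ha b hb
  have hJ : ∀ {x}, Equiv.swap a b x ∈ J ↔ x ∈ J := by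
    intro x
    rw [Equiv.swap_apply_def]
    split_ifs with h₁ h₂ <;> simp_all
  have hsub : ∀ J' ⊆ J, J'.map (Equiv.swap a b).toEmbedding ⊆ J := by
    intro J' h x hx
    obtain ⟨y, hy, rfl⟩ := Finset.mem_map.1 hx
    exact hJ.2 (h hy)
  rw [_root_.Bplus, map_sum]
  refine Finset.sum_nbij' (fun J' => J'.map (Equiv.swap a b).toEmbedding)
    (fun J' => J'.map (Equiv.swap a b).toEmbedding) ?_ ?_ ?_ ?_ ?_
  · intro J' h
    rw [Finset.mem_powersetCard] at h ⊢
    exact ⟨hsub J' h.1, by rw [Finset.card_map, h.2]⟩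
  · intro J' h
    rw [Finset.mem_powersetCard] at h ⊢
    exact ⟨hsub J' h.1, by rw [Finset.card_map, h.2]⟩
  · intro J' _
    ext x
    simp
  · intro J' _
    ext x
    simp
  · intro J' h
    have h' := hsub J' (Finset.mem_powersetCard.1 h).1
    rw [map_mul, rename_DJ, hf a ha b hb, zJ, zJ, map_prod, Finset.prod_map]
    · simp
    · rw [hf a ha b hb]
      exact hf.mono h'

theorem DJ_zero_eq (β : F) {J : Finset (Fin N)} {f : MvPolynomial (Fin N) F} (hf : SymmOn J f) :
    DJ β 0 J f = zJ J * nablaList β (J.sort (· ≤ ·)) f := by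
  rw [DJ, zJ_eq_prod_sort]
  exact Dlist_zero_eq β (Finset.sort_nodup _ _) fun i hi j hj =>
    hf i (by simpa using hi) j (by simpa using hj)

/-- The kernel of `Ñ_{k+1}` on symmetric functions is preserved by `B⁺_k`. -/
theorem DJ_zero_Bplus_eq_zero (β : F) {k : ℕ} {J : Finset (Fin N)} (hJ : J.card = k + 1)
    {f : MvPolynomial (Fin N) F} (hf : SymmOn J f) (h0 : DJ β 0 J f = 0) :
    DJ β 0 J (Bplus β k J f) = 0 := by
  rw [DJ_zero_eq β hf.Bplus, Bplus, map_sum, Finset.sum_eq_zero, mul_zero]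
  intro J' h
  rw [Finset.mem_powersetCard] at h
  obtain ⟨j, hjJ, hj⟩ := Finset.exists_mem_notMem_of_card_lt_card (s := J') (t := J) (by omega)
  have hins : insert j J' = J := by
    refine Finset.eq_of_subset_of_card_le (Finset.insert_subset hjJ h.1) ?_
    rw [Finset.card_insert_of_notMem hj]
    omega
  have hnd : (j :: J'.sort (· ≤ ·)).Nodup :=
    List.nodup_cons.2 ⟨by simpa using hj, Finset.sort_nodup _ _⟩
  have hperm : (j :: J'.sort (· ≤ ·)).Perm (J.sort (· ≤ ·)) :=
    sort_perm_of_nodup hnd fun x => by simp [← hins]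
  have hD : nabla β j (DJ β 1 J' f) = 0 := by
    have : Dlist β 0 (j :: J'.sort (· ≤ ·)) f = 0 := by
      rw [Dlist_perm β hperm hnd, ← DJ, h0]
      intro a ha b hb
      exact hf a (by simpa using hperm.mem_iff.1 ha) b (by simpa using hperm.mem_iff.1 hb)
    simp only [Dlist, Dop, Nat.cast_zero, zero_mul, zero_smul, add_zero, zero_add] at this
    exact (mul_eq_zero.1 this).resolve_left (X_ne_zero j)
  rw [← nablaList_perm β hperm, nablaList_cons, nabla_nablaList, zJ_eq_prod_sort]
  exact nablaList_nabla_prod_X_mul_eq_zero β (Finset.sort_nodup _ _) (by simpa using hj) hD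

/-- The polynomials symmetric in the variables indexed by `S`, as a submodule. -/
def symmOnSubmodule (S : Finset (Fin N)) : Submodule F (MvPolynomial (Fin N) F) where
  carrier := {f | SymmOn S f}
  add_mem' hf hg i hi j hj := by rw [map_add, hf i hi j hj, hg i hi j hj]
  zero_mem' i _ j _ := map_zero _
  smul_mem' c f hf i hi j hj := by rw [map_smul, hf i hi j hj]

/-- Over a field, `G` factors through `T` on the left as soon as `ker T ≤ ker G`. -/
theorem exists_comp_eq_of_ker_le_ker {V W U : Type*} [AddCommGroup V] [Module F V]
    [AddCommGroup W] [Module F W] [AddCommGroup U] [Module F U] (T : V →ₗ[F] W) (G : V →ₗ[F] U)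
    (h : LinearMap.ker T ≤ LinearMap.ker G) : ∃ A : W →ₗ[F] U, A.comp T = G := by
  obtain ⟨A, hA⟩ := LinearMap.exists_extend
    (((LinearMap.ker T).liftQ G h).comp T.quotKerEquivRange.symm.toLinearMap)
  refine ⟨A, LinearMap.ext fun v => ?_⟩
  have := LinearMap.congr_fun hA (T.quotKerEquivRange (Submodule.Quotient.mk v))
  simpa using this

end CommutatorKernel

/-- with Dunkl operators built from `M ≥ k+1 ≥ 2` variables, there is a
linear operator `A` such that `[Ñ_{k+1}, B⁺_{k,{1,…,k+1}}] f = A (Ñ_{k+1} f)` for every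
`f` symmetric in the variables `z_1,…,z_{k+1}`. (0-indexed: `{1,…,k+1}` is `{x | x < k+1}`.) -/
theorem statement_12 {F : Type*} [Field F] [CharZero F] {M : ℕ} (β : F) (k : ℕ)
    (hk : 2 ≤ k + 1) (hkM : k + 1 ≤ M) :
    ∃ A : MvPolynomial (Fin M) F →ₗ[F] MvPolynomial (Fin M) F,
      ∀ f : MvPolynomial (Fin M) F,
        SymmOn (Finset.univ.filter (fun x : Fin M => (x : ℕ) < k + 1)) f →
        DJ β 0 (Finset.univ.filter (fun x : Fin M => (x : ℕ) < k + 1))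
            (Bplus β k (Finset.univ.filter (fun x : Fin M => (x : ℕ) < k + 1)) f)
          - Bplus β k (Finset.univ.filter (fun x : Fin M => (x : ℕ) < k + 1))
              (DJ β 0 (Finset.univ.filter (fun x : Fin M => (x : ℕ) < k + 1)) f)
        = A (DJ β 0 (Finset.univ.filter (fun x : Fin M => (x : ℕ) < k + 1)) f) := by
  set J : Finset (Fin M) := Finset.univ.filter (fun x : Fin M => (x : ℕ) < k + 1) with hJ
  have hcard : J.card = k + 1 := by
    rw [hJ, Fin.card_filter_val_lt, min_eq_right hkM]
  let T := DlistLin β 0 (J.sort (· ≤ ·))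
  let B := BplusLin β k J
  have hB : ∀ f, B f = Bplus β k J f := BplusLin_apply β k J
  obtain ⟨A, hA⟩ := exists_comp_eq_of_ker_le_ker (T.comp (symmOnSubmodule J).subtype)
    ((T.comp B - B.comp T).comp (symmOnSubmodule J).subtype) (by
      rintro ⟨f, hf⟩ h
      have h0 : T f = 0 := h
      have h1 : T (Bplus β k J f) = 0 := DJ_zero_Bplus_eq_zero β hcard hf h0
      change T (B f) - B (T f) = 0
      rw [h0, hB, h1, map_zero, sub_zero])
  refine ⟨A, fun f hf => ?_⟩
  have := LinearMap.congr_fun hA ⟨f, hf⟩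
  simp only [LinearMap.comp_apply, LinearMap.sub_apply, Submodule.subtype_apply, hB] at this
  exact this.symm
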